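/- Key identity in the proof of the maximum entropy principle: under the above hypotheses (μ = λ.withDensity φ a probability measure, φ·log φ λ-integrable, H₀ integrable with respect to both μ and ℙ∞, and ∫_P H₀ dμ = ∫_P H₀ dℙ∞), one has the exact identity H(μ ∥ λ) − H(ℙ∞ ∥ λ) = H(μ ∥ ℙ∞), explicitly: ∫_P φ·log φ dλ − ∫_P ψ·log ψ dλ = ∫_P φ·log(φ/ψ) dλ, where ψ := Z⁻¹·exp(−β·H₀) (which is strictly positive everywhere, so the quotient φ/ψ is well defined). -/

import Mathlib

open MeasureTheory Real

theorem gibbs_aux {P : Type*} [MeasurableSpace P] (lam : Measure P) (f g : P → ℝ)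
    (hf : Measurable f) (hf0 : ∀ x, 0 ≤ f x)
    (hg : Integrable g (lam.withDensity (fun x => ENNReal.ofReal (f x)))) :
    Integrable (fun x => f x * g x) lam ∧
      ∫ x, g x ∂(lam.withDensity (fun x => ENNReal.ofReal (f x))) = ∫ x, f x * g x ∂lam := by
  have hm : Measurable (fun x => ENNReal.ofReal (f x)) := hf.ennreal_ofReal
  have hlt : ∀ᵐ x ∂lam, ENNReal.ofReal (f x) < ⊤ := by simp
  constructor
  · have := (integrable_withDensity_iff_integrable_smul' hm hlt).1 hg
    simpa [ENNReal.toReal_ofReal, hf0] using this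
  · rw [integral_withDensity_eq_integral_toReal_smul hm hlt]
    simp [ENNReal.toReal_ofReal, hf0]

/-- **Key identity in the proof of the maximum entropy principle**:
`H(μ ∥ λ) − H(ℙ∞ ∥ λ) = H(μ ∥ ℙ∞)`, i.e.
`∫ φ log φ dλ − ∫ ψ log ψ dλ = ∫ φ log(φ/ψ) dλ`,
where `ψ = Z⁻¹ exp (-β H₀)` is the (everywhere strictly positive) Gibbs density. -/
theorem gibbs_relative_entropy_identity
    {P : Type*} [MeasurableSpace P] (lam : Measure P) [SigmaFinite lam] (hlam : lam ≠ 0)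
    (H0 : P → ℝ) (hH0meas : Measurable H0) (β : ℝ) (hβ : 0 < β)
    (hZint : Integrable (fun x => Real.exp (-β * H0 x)) lam)
    (Z : ℝ) (hZ : Z = ∫ x, Real.exp (-β * H0 x) ∂lam)
    (ψ : P → ℝ) (hψ : ψ = fun x => Z⁻¹ * Real.exp (-β * H0 x))
    (Pinf : Measure P) (hPinf : Pinf = lam.withDensity (fun x => ENNReal.ofReal (ψ x)))
    (φ : P → ℝ) (hφmeas : Measurable φ) (hφnonneg : ∀ x, 0 ≤ φ x)
    (μ : Measure P) (hμ : μ = lam.withDensity (fun x => ENNReal.ofReal (φ x)))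
    (hμprob : IsProbabilityMeasure μ)
    (hφlog : Integrable (fun x => φ x * Real.log (φ x)) lam)
    (hH0μ : Integrable H0 μ) (hH0Pinf : Integrable H0 Pinf)
    (henergy : ∫ x, H0 x ∂μ = ∫ x, H0 x ∂Pinf) :
    (∫ x, φ x * Real.log (φ x) ∂lam) - (∫ x, ψ x * Real.log (ψ x) ∂lam)
      = ∫ x, φ x * Real.log (φ x / ψ x) ∂lam := by
  have hZpos : 0 < Z := by
    have : NeZero lam := ⟨hlam⟩
    rw [hZ]
    exact integral_exp_pos hZint
  have hψpos : ∀ x, 0 < ψ x := by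
    intro x
    rw [hψ]
    positivity
  have hψmeas : Measurable ψ := by
    rw [hψ]
    fun_prop
  have hlogψ : ∀ x, Real.log (ψ x) = -Real.log Z - β * H0 x := by
    intro x
    rw [hψ]
    simp only
    rw [Real.log_mul (by positivity) (Real.exp_ne_zero _), Real.log_inv, Real.log_exp]
    ring
  have hψint : Integrable ψ lam := by
    rw [hψ]
    exact hZint.const_mul _
  have hψone : ∫ x, ψ x ∂lam = 1 := by
    rw [hψ, integral_const_mul, ← hZ]
    exact inv_mul_cancel₀ hZpos.ne'
  subst hμ hPinf
  obtain ⟨i1, e1⟩ := gibbs_aux lam φ H0 hφmeas hφnonneg hH0μ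
  obtain ⟨i2, e2⟩ := gibbs_aux lam ψ H0 hψmeas (fun x => (hψpos x).le) hH0Pinf
  obtain ⟨i3, e3⟩ := gibbs_aux lam φ (fun _ => 1) hφmeas hφnonneg (integrable_const 1)
  simp only [mul_one, integral_const, probReal_univ, smul_eq_mul] at i3 e3
  rw [e1, e2] at henergy
  have a1 : ∫ x, ψ x * Real.log (ψ x) ∂lam
      = -Real.log Z - β * ∫ x, ψ x * H0 x ∂lam := by
    have : ∀ x, ψ x * Real.log (ψ x) = -Real.log Z * ψ x - β * (ψ x * H0 x) := by
      intro x
      rw [hlogψ]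
      ring
    simp_rw [this]
    rw [integral_sub (hψint.const_mul _) (i2.const_mul _), integral_const_mul,
      integral_const_mul, hψone, mul_one]
  have a2 : ∫ x, φ x * Real.log (φ x / ψ x) ∂lam
      = ∫ x, φ x * Real.log (φ x) ∂lam - (-Real.log Z - β * ∫ x, φ x * H0 x ∂lam) := by
    have : ∀ x, φ x * Real.log (φ x / ψ x)
        = φ x * Real.log (φ x) - (-Real.log Z * φ x - β * (φ x * H0 x)) := by
      intro x
      by_cases h : φ x = 0
      · simp [h]
      · rw [Real.log_div h (hψpos x).ne', hlogψ]
        ring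
    simp_rw [this]
    have i4 : Integrable (fun x => -Real.log Z * φ x - β * (φ x * H0 x)) lam :=
      (i3.const_mul _).sub (i1.const_mul _)
    rw [integral_sub hφlog i4,
      integral_sub (i3.const_mul _) (i1.const_mul _), integral_const_mul,
      integral_const_mul, ← e3, mul_one]
  rw [a1, a2, henergy]
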